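/- (Uniform stability / nonlocal Poincaré inequality.) Let Ω̃ ⊂ ℝ^d be an open bounded connected domain and δ₀ > 0. Then there exists a constant C > 0 depending only on Ω̃, δ₀, ρ and d such that for every δ ∈ (0, δ₀] and every u ∈ L²(ℝ^d) with u = 0 almost everywhere on ℝ^d \ Ω̃: (1/2) ∫_{ℝ^d} ∫_{ℝ^d} ρ_δ(|y − x|)(u(y) − u(x))² dy dx ≥ C ‖u‖²_{L²(ℝ^d)}. -/

import Mathlib

open MeasureTheory Real
open scoped BigOperators

noncomputable section

/-- The rescaled kernel `ρ_δ(r) = δ^{-(d+2)} ρ(r/δ)`. -/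
def rhoScaled (d : ℕ) (ρ : ℝ → ℝ) (δ : ℝ) (r : ℝ) : ℝ :=
  (δ ^ (d + 2))⁻¹ * ρ (r / δ)

section helpers
variable {d : ℕ}

lemma aux_shift {u : (EuclideanSpace ℝ (Fin d)) → ℝ} (hu : MemLp u 2 volume) (t : (EuclideanSpace ℝ (Fin d))) :
    MemLp (fun x => u (x + t)) 2 volume :=
  hu.comp_measurePreserving (measurePreserving_add_right volume t)

lemma aux_diff_int {u : (EuclideanSpace ℝ (Fin d)) → ℝ} (hu : MemLp u 2 volume) (s t : (EuclideanSpace ℝ (Fin d))) :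
    Integrable (fun x => (u (x + s) - u (x + t)) ^ 2) volume :=
  ((aux_shift hu s).sub (aux_shift hu t)).integrable_sq

lemma aux_multiple {u : (EuclideanSpace ℝ (Fin d)) → ℝ} (hu : MemLp u 2 volume) (s : (EuclideanSpace ℝ (Fin d))) (k : ℕ) :
    ∫ x, (u (x + (k : ℝ) • s) - u x) ^ 2 ≤ (k : ℝ) ^ 2 * ∫ x, (u (x + s) - u x) ^ 2 := by
  have hpt : ∀ x, (u (x + (k : ℝ) • s) - u x) ^ 2 ≤
      (k : ℝ) * ∑ j ∈ Finset.range k,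
        (u (x + ((j + 1 : ℕ) : ℝ) • s) - u (x + (j : ℝ) • s)) ^ 2 := by
    intro x
    have h1 : u (x + (k : ℝ) • s) - u x = ∑ j ∈ Finset.range k,
        (u (x + ((j + 1 : ℕ) : ℝ) • s) - u (x + (j : ℝ) • s)) := by
      rw [Finset.sum_range_sub (fun j : ℕ => u (x + (j : ℝ) • s)) k]
      simp
    rw [h1]
    have := sq_sum_le_card_mul_sum_sq (s := Finset.range k)
      (f := fun j : ℕ => (u (x + ((j + 1 : ℕ) : ℝ) • s) - u (x + (j : ℝ) • s)))
    simpa using this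
  have hI : ∀ j ∈ Finset.range k, Integrable (fun x =>
      (u (x + ((j + 1 : ℕ) : ℝ) • s) - u (x + (j : ℝ) • s)) ^ 2) volume :=
    fun j _ => aux_diff_int hu _ _
  have hl : Integrable (fun x => (u (x + (k : ℝ) • s) - u x) ^ 2) volume := by
    simpa using aux_diff_int hu ((k : ℝ) • s) 0
  calc _ ≤ ∫ x, (k : ℝ) * ∑ j ∈ Finset.range k,
        (u (x + ((j + 1 : ℕ) : ℝ) • s) - u (x + (j : ℝ) • s)) ^ 2 :=
        integral_mono hl ((integrable_finsetSum _ hI).const_mul _) hpt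
    _ = (k : ℝ) * ∑ j ∈ Finset.range k, ∫ x,
        (u (x + ((j + 1 : ℕ) : ℝ) • s) - u (x + (j : ℝ) • s)) ^ 2 := by
        rw [integral_const_mul, integral_finsetSum _ hI]
    _ = (k : ℝ) * ∑ j ∈ Finset.range k, ∫ x, (u (x + s) - u x) ^ 2 := by
        congr 1
        refine Finset.sum_congr rfl fun j _ => ?_
        rw [← integral_add_right_eq_self (fun x => (u (x + s) - u x) ^ 2) ((j : ℝ) • s)]
        refine integral_congr_ae (Filter.Eventually.of_forall fun x => ?_)
        have : x + ((j + 1 : ℕ) : ℝ) • s = x + (j : ℝ) • s + s := by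
          push_cast
          module
        simp only [this]
    _ = _ := by simp; ring

lemma aux_far {u : (EuclideanSpace ℝ (Fin d)) → ℝ} (hu : MemLp u 2 volume) {Ω : Set (EuclideanSpace ℝ (Fin d))} {D : ℝ}
    (hD : ∀ x ∈ Ω, ∀ y ∈ Ω, dist x y ≤ D)
    (h0 : ∀ᵐ x : (EuclideanSpace ℝ (Fin d)), x ∉ Ω → u x = 0) (t : (EuclideanSpace ℝ (Fin d))) (ht : D < ‖t‖) :
    ∫ x, (u (x + t) - u x) ^ 2 = 2 * ∫ x, (u x) ^ 2 := by
  have h0' : ∀ᵐ x : (EuclideanSpace ℝ (Fin d)), x + t ∉ Ω → u (x + t) = 0 :=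
    (measurePreserving_add_right volume t).quasiMeasurePreserving.ae h0
  have h1 : ∫ x, (u (x + t) - u x) ^ 2 = ∫ x, ((u (x + t)) ^ 2 + (u x) ^ 2) := by
    refine integral_congr_ae ?_
    filter_upwards [h0, h0'] with x hx hx'
    have : u (x + t) = 0 ∨ u x = 0 := by
      by_cases h : x ∈ Ω
      · left
        apply hx'
        intro h'
        have := hD _ h' _ h
        simp [dist_eq_norm] at this
        linarith
      · exact Or.inr (hx h)
    rcases this with h | h <;> simp [h]
  rw [h1, integral_add (aux_shift hu t).integrable_sq hu.integrable_sq,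
    integral_add_right_eq_self (fun x => (u x) ^ 2) t]
  ring

lemma aux_lower {u : (EuclideanSpace ℝ (Fin d)) → ℝ} (hu : MemLp u 2 volume) {Ω : Set (EuclideanSpace ℝ (Fin d))} {D δ₀ : ℝ} (hD0 : 0 ≤ D)
    (hδ₀ : 0 < δ₀) (hD : ∀ x ∈ Ω, ∀ y ∈ Ω, dist x y ≤ D)
    (h0 : ∀ᵐ x : (EuclideanSpace ℝ (Fin d)), x ∉ Ω → u x = 0) (s : (EuclideanSpace ℝ (Fin d))) (hs : ‖s‖ ≤ δ₀) :
    2 / (D + 2 * δ₀) ^ 2 * (∫ x, (u x) ^ 2) * ‖s‖ ^ 2 ≤ ∫ x, (u (x + s) - u x) ^ 2 := by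
  have hF : 0 ≤ ∫ x, (u (x + s) - u x) ^ 2 := integral_nonneg fun x => sq_nonneg _
  rcases eq_or_ne s 0 with rfl | hs0
  · simp
  have hsp : 0 < ‖s‖ := norm_pos_iff.2 hs0
  set k : ℕ := ⌊D / ‖s‖⌋₊ + 1 with hk
  have hk1 : D / ‖s‖ < k := by
    rw [hk]; push_cast; exact Nat.lt_floor_add_one _
  have hk2 : (k : ℝ) ≤ D / ‖s‖ + 1 := by
    rw [hk]; push_cast
    have := Nat.floor_le (div_nonneg hD0 hsp.le)
    linarith
  have hks : D < ‖(k : ℝ) • s‖ := by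
    rw [norm_smul]
    simp only [Real.norm_natCast]
    exact (div_lt_iff₀ hsp).1 hk1
  have hks2 : (k : ℝ) * ‖s‖ ≤ D + 2 * δ₀ := by
    calc (k : ℝ) * ‖s‖ ≤ (D / ‖s‖ + 1) * ‖s‖ := by gcongr
      _ = D + ‖s‖ := by field_simp
      _ ≤ _ := by linarith
  have hm := aux_multiple hu s k
  rw [aux_far hu hD h0 _ hks] at hm
  have hpos : 0 < (D + 2 * δ₀) ^ 2 := by positivity
  rw [div_mul_eq_mul_div, div_mul_eq_mul_div, div_le_iff₀ hpos]
  calc 2 * (∫ x, (u x) ^ 2) * ‖s‖ ^ 2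
      ≤ ((k : ℝ) ^ 2 * ∫ x, (u (x + s) - u x) ^ 2) * ‖s‖ ^ 2 := by gcongr
    _ = (∫ x, (u (x + s) - u x) ^ 2) * ((k : ℝ) * ‖s‖) ^ 2 := by ring
    _ ≤ _ := by gcongr

lemma aux_prod_int {u : (EuclideanSpace ℝ (Fin d)) → ℝ} (hu : MemLp u 2 volume) {K : (EuclideanSpace ℝ (Fin d)) → ℝ} (hK : Integrable K volume)
    (hK0 : ∀ s, 0 ≤ K s) :
    Integrable (fun p : (EuclideanSpace ℝ (Fin d)) × (EuclideanSpace ℝ (Fin d)) => K p.2 * (u (p.1 + p.2) - u p.1) ^ 2)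
      (volume.prod volume) := by
  have hmp : MeasurePreserving (fun p : (EuclideanSpace ℝ (Fin d)) × (EuclideanSpace ℝ (Fin d)) => (p.1 + p.2, p.2))
      (volume.prod volume) (volume.prod volume) := measurePreserving_add_prod volume volume
  have hA : Integrable (fun p : (EuclideanSpace ℝ (Fin d)) × (EuclideanSpace ℝ (Fin d)) => (u p.1) ^ 2 * K p.2) (volume.prod volume) :=
    hu.integrable_sq.mul_prod hK
  have hB : Integrable (fun p : (EuclideanSpace ℝ (Fin d)) × (EuclideanSpace ℝ (Fin d)) => (u (p.1 + p.2)) ^ 2 * K p.2) (volume.prod volume) :=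
    hmp.integrable_comp_of_integrable hA
  have hu1 : AEStronglyMeasurable (fun p : (EuclideanSpace ℝ (Fin d)) × (EuclideanSpace ℝ (Fin d)) => u p.1) (volume.prod volume) :=
    hu.1.comp_fst
  have hu2 : AEStronglyMeasurable (fun p : (EuclideanSpace ℝ (Fin d)) × (EuclideanSpace ℝ (Fin d)) => u (p.1 + p.2)) (volume.prod volume) :=
    hu1.comp_measurePreserving hmp
  refine ((hA.add hB).const_mul 2).mono' (hK.1.comp_snd.mul ((hu2.sub hu1).pow 2)) ?_
  refine Filter.Eventually.of_forall fun p => ?_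
  have h1 := hK0 p.2
  rw [Real.norm_of_nonneg (mul_nonneg h1 (sq_nonneg _))]
  simp only [Pi.add_apply]
  nlinarith [mul_nonneg h1 (sq_nonneg (u (p.1 + p.2) + u p.1))]

lemma aux_fubini {u : (EuclideanSpace ℝ (Fin d)) → ℝ} (hu : MemLp u 2 volume) {K : (EuclideanSpace ℝ (Fin d)) → ℝ} (hK : Integrable K volume)
    (hK0 : ∀ s, 0 ≤ K s) :
    ∫ x, ∫ y, K (y - x) * (u y - u x) ^ 2 = ∫ s, K s * ∫ x, (u (x + s) - u x) ^ 2 := by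
  have h1 : ∀ x : (EuclideanSpace ℝ (Fin d)), ∫ y, K (y - x) * (u y - u x) ^ 2
      = ∫ s, K s * (u (x + s) - u x) ^ 2 := by
    intro x
    rw [← integral_add_left_eq_self (fun y => K (y - x) * (u y - u x) ^ 2) x]
    simp
  simp_rw [h1]
  rw [integral_integral_swap (f := fun x s => K s * (u (x + s) - u x) ^ 2)
    (aux_prod_int hu hK hK0)]
  simp_rw [integral_const_mul]

lemma aux_fubini_int {u : (EuclideanSpace ℝ (Fin d)) → ℝ} (hu : MemLp u 2 volume) {K : (EuclideanSpace ℝ (Fin d)) → ℝ} (hK : Integrable K volume)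
    (hK0 : ∀ s, 0 ≤ K s) :
    Integrable (fun s => K s * ∫ x, (u (x + s) - u x) ^ 2) volume := by
  have := (aux_prod_int hu hK hK0).integral_prod_right
  simpa only [integral_const_mul] using this

lemma aux_kernel_int (ρ : ℝ → ℝ) (hρ_nonneg : ∀ r, 0 ≤ ρ r)
    (hρ_mono : ∀ r₁ r₂, 0 ≤ r₁ → r₁ ≤ r₂ → ρ r₂ ≤ ρ r₁)
    (hρ_supp : ∀ r, 1 < r → ρ r = 0) (n : ℕ) :
    Integrable (fun s : (EuclideanSpace ℝ (Fin d)) => ρ ‖s‖ * ‖s‖ ^ n) volume := by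
  have hm : Measurable (fun s : (EuclideanSpace ℝ (Fin d)) => ρ ‖s‖) := by
    have ha : Antitone (fun r : ℝ => ρ (max r 0)) := fun a b h =>
      hρ_mono _ _ (le_max_right _ _) (max_le_max_right 0 h)
    have := ha.measurable.comp (measurable_norm (α := (EuclideanSpace ℝ (Fin d))))
    have he : (fun s : (EuclideanSpace ℝ (Fin d)) => ρ ‖s‖) = (fun r : ℝ => ρ (max r 0)) ∘ (fun s : (EuclideanSpace ℝ (Fin d)) => ‖s‖) := by
      funext s
      simp
    rw [he]
    exact this
  have hind : Integrable (Set.indicator (Metric.closedBall (0 : (EuclideanSpace ℝ (Fin d))) 1) (fun _ => ρ 0)) volume :=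
    (integrable_indicator_iff Metric.isClosed_closedBall.measurableSet).2
      (integrableOn_const (measure_closedBall_lt_top).ne)
  refine hind.mono' ((hm.mul (measurable_norm.pow_const n)).aestronglyMeasurable) ?_
  refine Filter.Eventually.of_forall fun s => ?_
  rw [Real.norm_of_nonneg (mul_nonneg (hρ_nonneg _) (by positivity))]
  by_cases h : ‖s‖ ≤ 1
  · rw [Set.indicator_of_mem (by simpa using h)]
    calc ρ ‖s‖ * ‖s‖ ^ n ≤ ρ 0 * 1 := by
          gcongr
          · exact hρ_nonneg _
          · exact hρ_mono _ _ le_rfl (norm_nonneg _)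
          · exact pow_le_one₀ (norm_nonneg _) h
      _ = ρ 0 := mul_one _
  · rw [hρ_supp _ (not_le.1 h), zero_mul]
    exact Set.indicator_nonneg (fun _ _ => hρ_nonneg _) _

lemma aux_scaled_eq (ρ : ℝ → ℝ) {δ : ℝ} (hδ : 0 < δ) (n : ℕ) (s : (EuclideanSpace ℝ (Fin d))) :
    rhoScaled d ρ δ ‖s‖ * ‖s‖ ^ n
      = (δ ^ (d + 2))⁻¹ * δ ^ n * (fun t : (EuclideanSpace ℝ (Fin d)) => ρ ‖t‖ * ‖t‖ ^ n) (δ⁻¹ • s) := by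
  simp only [rhoScaled, norm_smul, norm_inv, Real.norm_of_nonneg hδ.le, div_eq_inv_mul]
  have h : δ ^ n * (δ⁻¹ * ‖s‖) ^ n = ‖s‖ ^ n := by
    rw [← mul_pow, mul_inv_cancel_left₀ hδ.ne']
  rw [← h]
  ring

lemma aux_moment (ρ : ℝ → ℝ) {δ : ℝ} (hδ : 0 < δ) :
    ∫ s : (EuclideanSpace ℝ (Fin d)), rhoScaled d ρ δ ‖s‖ * ‖s‖ ^ 2 = ∫ s : (EuclideanSpace ℝ (Fin d)), ρ ‖s‖ * ‖s‖ ^ 2 := by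
  simp_rw [aux_scaled_eq ρ hδ 2]
  rw [integral_const_mul,
    Measure.integral_comp_inv_smul volume (fun t : (EuclideanSpace ℝ (Fin d)) => ρ ‖t‖ * ‖t‖ ^ 2) δ]
  simp only [finrank_euclideanSpace, Fintype.card_fin, smul_eq_mul, abs_of_pos (pow_pos hδ d)]
  rw [← mul_assoc]
  have : (δ ^ (d + 2))⁻¹ * δ ^ 2 * δ ^ d = 1 := by
    field_simp
    try ring
  rw [this, one_mul]

end helpers

/-- uniform stability (nonlocal Poincaré inequality): for `δ ∈ (0, δ₀]` and
`u ∈ L²(ℝ^d)` vanishing a.e. outside the bounded open connected set `Ω̃`,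
`(1/2)∫∫ ρ_δ(|y−x|)(u(y)−u(x))² ≥ C‖u‖²_{L²}`. -/
theorem nonlocal_uniform_stability (d : ℕ) (hd : 1 ≤ d) (ρ : ℝ → ℝ)
    (hρ_nonneg : ∀ r, 0 ≤ ρ r)
    (hρ_mono : ∀ r₁ r₂, 0 ≤ r₁ → r₁ ≤ r₂ → ρ r₂ ≤ ρ r₁)
    (hρ_supp : ∀ r, 1 < r → ρ r = 0)
    (hρ_mom2 : ∫ s in Metric.ball (0 : EuclideanSpace ℝ (Fin d)) 1,
        ρ ‖s‖ * ‖s‖^2 = 2 * d)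
    (Ωt : Set (EuclideanSpace ℝ (Fin d))) (hΩo : IsOpen Ωt)
    (hΩb : Bornology.IsBounded Ωt) (hΩc : IsConnected Ωt)
    (δ₀ : ℝ) (hδ₀ : 0 < δ₀) :
    ∃ C : ℝ, 0 < C ∧ ∀ δ : ℝ, 0 < δ → δ ≤ δ₀ →
      ∀ u : EuclideanSpace ℝ (Fin d) → ℝ, MemLp u 2 volume →
      (∀ᵐ x : EuclideanSpace ℝ (Fin d), x ∉ Ωt → u x = 0) →
      C * ∫ x : EuclideanSpace ℝ (Fin d), (u x)^2 ≤
        (1/2) * ∫ x : EuclideanSpace ℝ (Fin d), ∫ y : EuclideanSpace ℝ (Fin d),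
          rhoScaled d ρ δ ‖y - x‖ * (u y - u x)^2 := by
  obtain ⟨D, hD⟩ := Metric.isBounded_iff.1 hΩb
  have hD' : ∀ x ∈ Ωt, ∀ y ∈ Ωt, dist x y ≤ max D 0 :=
    fun x hx y hy => (hD hx hy).trans (le_max_left _ _)
  have hD0 : 0 ≤ max D 0 := le_max_right _ _
  generalize max D 0 = D' at hD' hD0
  have hd' : (0 : ℝ) < d := by exact_mod_cast hd
  refine ⟨2 * d / (D' + 2 * δ₀) ^ 2, by positivity, ?_⟩
  intro δ hδ hδδ u hu h0
  have hint : ∀ n : ℕ, Integrable (fun s : EuclideanSpace ℝ (Fin d) =>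
      rhoScaled d ρ δ ‖s‖ * ‖s‖ ^ n) volume := by
    intro n
    simp_rw [aux_scaled_eq ρ hδ n]
    exact ((aux_kernel_int ρ hρ_nonneg hρ_mono hρ_supp n).comp_smul
      (inv_ne_zero hδ.ne')).const_mul _
  have hK : Integrable (fun s : EuclideanSpace ℝ (Fin d) => rhoScaled d ρ δ ‖s‖) volume := by
    simpa using hint 0
  have hK0 : ∀ s : EuclideanSpace ℝ (Fin d), 0 ≤ rhoScaled d ρ δ ‖s‖ := by
    intro s
    exact mul_nonneg (by positivity) (hρ_nonneg _)
  rw [aux_fubini (K := fun s => rhoScaled d ρ δ ‖s‖) hu hK hK0]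
  set c : ℝ := 2 / (D' + 2 * δ₀) ^ 2 * (∫ x, (u x) ^ 2) with hc
  have hc0 : 0 ≤ c := mul_nonneg (by positivity) (integral_nonneg fun x => sq_nonneg _)
  have hmom : (2 * d : ℝ) ≤ ∫ s : EuclideanSpace ℝ (Fin d), rhoScaled d ρ δ ‖s‖ * ‖s‖ ^ 2 := by
    rw [aux_moment ρ hδ, ← hρ_mom2]
    exact setIntegral_le_integral (aux_kernel_int ρ hρ_nonneg hρ_mono hρ_supp 2)
      (Filter.Eventually.of_forall fun s => mul_nonneg (hρ_nonneg _) (by positivity))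
  have hmain : ∫ s : EuclideanSpace ℝ (Fin d), c * (rhoScaled d ρ δ ‖s‖ * ‖s‖ ^ 2) ≤
      ∫ s : EuclideanSpace ℝ (Fin d), rhoScaled d ρ δ ‖s‖ * ∫ x, (u (x + s) - u x) ^ 2 := by
    refine integral_mono ((hint 2).const_mul c)
      (aux_fubini_int (K := fun s => rhoScaled d ρ δ ‖s‖) hu hK hK0) fun s => ?_
    by_cases hs : ‖s‖ ≤ δ
    · have := mul_le_mul_of_nonneg_left
        (aux_lower hu hD0 hδ₀ hD' h0 s (hs.trans hδδ)) (hK0 s)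
      rw [← hc] at this
      simp only
      linarith
    · have : rhoScaled d ρ δ ‖s‖ = 0 := by
        rw [rhoScaled, hρ_supp _ ((one_lt_div hδ).2 (not_le.1 hs)), mul_zero]
      simp [this]
  rw [integral_const_mul] at hmain
  have h3 := mul_le_mul_of_nonneg_left hmom hc0
  have h4 : 2 * d / (D' + 2 * δ₀) ^ 2 * ∫ x, (u x) ^ 2 = (1 / 2) * (c * (2 * d)) := by
    rw [hc]; ring
  rw [h4]
  linarith

end
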